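/- arXiv:0801.2088 — 4 statements merged into one kernel-verified Lean document; each statement's English description precedes it below -/
import Mathlib

section
/- Let a ∈ A with γ(a) > 0 and let n ∈ ℕ. Write σ^n(a) = p_n s_n where p_n is a prefix of σ^n(a) at which the minimum of γ over all prefixes of σ^n(a) is attained, i.e. γ(p_n) = min{ γ(u) : u a prefix of σ^n(a) }. Then γ(s_n) ≥ θ_2^n γ(a). -/
open scoped BigOperators
open IntermediateField Filter

/-- A substitution applied to a word (concatenation of the images of its letters). -/
def substW {A : Type*} (σ : A → List A) (w : List A) : List A := (w.map σ).flatten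

/-- `σ^n(a)`: the `n`-th iterate of the substitution on the letter `a`. -/
def substIter {A : Type*} (σ : A → List A) (n : ℕ) (a : A) : List A := (substW σ)^[n] [a]

/-- `γ(w)`: the sum of `γ` over the letters of the word `w` (with `γ(ε) = 0`). -/
def gammaW {A : Type*} (γ : A → ℝ) (w : List A) : ℝ := (w.map γ).sum

/-- The finite window `x_m x_{m+1} … x_{m+len-1}` of a two-sided sequence `x`. -/
def wordOf {A : Type*} (x : ℤ → A) (m : ℤ) (len : ℕ) : List A :=
  (List.range len).map (fun k => x (m + k))

/-- Membership in the subshift `X_σ`: every finite subword of `x` is a subword of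
some `σ^N(a)`. -/
def InXsigma {A : Type*} (σ : A → List A) (x : ℤ → A) : Prop :=
  ∀ (m : ℤ) (len : ℕ), ∃ (N : ℕ) (a : A), (wordOf x m len) <:+: substIter σ N a

/-- `γ_n(x)`: equals `γ(x_0 … x_{n-1})` for `n > 0`, `0` for `n = 0`, and
`γ(x_n … x_{-1})` for `n < 0`. -/
def gammaZ {A : Type*} (γ : A → ℝ) (x : ℤ → A) (n : ℤ) : ℝ :=
  if 0 ≤ n then gammaW γ (wordOf x 0 n.toNat) else gammaW γ (wordOf x n (-n).toNat)

/-- A minimal point: a point of `X_σ` with `γ_n(x) ≥ 0` for all `n ∈ ℤ`. -/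
def IsMinimalPt {A : Type*} (σ : A → List A) (γ : A → ℝ) (x : ℤ → A) : Prop :=
  InXsigma σ x ∧ ∀ n : ℤ, 0 ≤ gammaZ γ x n

/-- Primitivity of a substitution: some power of `σ` applied to any letter
contains every letter. -/
def Primitive {A : Type*} (σ : A → List A) : Prop :=
  ∃ N : ℕ, 0 < N ∧ ∀ a b : A, b ∈ substIter σ N a

lemma gammaW_append {A : Type*} (γ : A → ℝ) (u v : List A) :
    gammaW γ (u ++ v) = gammaW γ u + gammaW γ v := by
  simp [gammaW]

lemma gammaW_eq_sum_count {A : Type*} [Fintype A] [DecidableEq A] (γ : A → ℝ) (w : List A) :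
    gammaW γ w = ∑ b : A, (w.count b : ℝ) * γ b := by
  induction w with
  | nil => simp [gammaW]
  | cons c w ih =>
    have hc : gammaW γ (c :: w) = γ c + gammaW γ w := by simp [gammaW]
    simp [hc, ih, List.count_cons, add_mul, Finset.sum_add_distrib, add_comm]

lemma gammaW_substW {A : Type*} {σ : A → List A} {γ : A → ℝ} {θ : ℝ}
    (h : ∀ a, gammaW γ (σ a) = θ * γ a) (w : List A) :
    gammaW γ (substW σ w) = θ * gammaW γ w := by
  induction w with
  | nil => simp [gammaW, substW]
  | cons c w ih =>
    have hs : substW σ (c :: w) = σ c ++ substW σ w := by simp [substW]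
    rw [hs, gammaW_append, h, ih]
    simp [gammaW, mul_add]

lemma gammaW_substIter {A : Type*} {σ : A → List A} {γ : A → ℝ} {θ : ℝ}
    (h : ∀ a, gammaW γ (σ a) = θ * γ a) (n : ℕ) (a : A) :
    gammaW γ (substIter σ n a) = θ ^ n * γ a := by
  induction n with
  | zero => simp [gammaW, substIter]
  | succ n ih =>
    have hs : substIter σ (n + 1) a = substW σ (substIter σ n a) :=
      Function.iterate_succ_apply' _ _ _
    rw [hs, gammaW_substW h, ih, pow_succ]
    ring

/-- Lemma 3.1 of the paper. If `γ(a) > 0` and `σ^n(a) = p ++ s`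
where `γ(p)` is minimal among the values of `γ` on prefixes of `σ^n(a)`, then
`γ(s) ≥ θ₂^n γ(a)`. -/
theorem statement_3 {A : Type*} [Fintype A] [DecidableEq A]
    (σ : A → List A) (hσ : ∀ a, σ a ≠ [])
    (hprim : Primitive σ)
    (hMpos : ∀ a b : A, 0 < (σ a).count b)
    (θ₁ θ₂ : ℝ) (hθ₁alg : IsAlgebraic ℚ θ₁)
    (hθ₂1 : 1 < θ₂) (hθ₂θ₁ : θ₂ < θ₁)
    (hconj : Polynomial.aeval θ₂ (minpoly ℚ θ₁) = 0)
    (lam : A → ℚ⟮θ₁⟯) (hlampos : ∀ a, (0:ℝ) < (lam a : ℝ))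
    (heig1 : ∀ a, ∑ b : A, ((σ a).count b : ℝ) * (lam b : ℝ) = θ₁ * (lam a : ℝ))
    (η : ℚ⟮θ₁⟯ →ₐ[ℚ] ℝ) (hη : η (AdjoinSimple.gen ℚ θ₁) = θ₂)
    (γ : A → ℝ) (hγ : ∀ a, γ a = η (lam a))
    (heig2 : ∀ a, ∑ b : A, ((σ a).count b : ℝ) * γ b = θ₂ * γ a)
    (a : A) (ha : 0 < γ a) (n : ℕ)
    (p s : List A) (hsplit : substIter σ n a = p ++ s)
    (hmin : ∀ q : List A, q <+: substIter σ n a → gammaW γ p ≤ gammaW γ q) :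
    θ₂ ^ n * γ a ≤ gammaW γ s := by
  have hγσ : ∀ b, gammaW γ (σ b) = θ₂ * γ b := fun b => by
    rw [gammaW_eq_sum_count, heig2]
  have htotal := gammaW_substIter hγσ n a
  rw [hsplit, gammaW_append] at htotal
  have hp : gammaW γ p ≤ 0 := by simpa [gammaW] using hmin [] List.nil_prefix
  linarith
end

section
/- For a ∈ A and n ∈ ℕ, let v_n(a) denote the minimum of Σ_{i=1}^{n+1} θ_2^{-i} γ(p_i) over all finite sequences (p_i,c_i,s_i)_{i=1}^{n+1} in A* × A × A* with c_0 = a and σ(c_{i-1}) = p_i c_i s_i for 1 ≤ i ≤ n+1. Then v(a) = lim_{n→∞} v_n(a), and moreover the infimum defining v(a) is attained: there exists x ∈ 𝒮 with c_0^x = a and v(a;x) = v(a). -/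
open scoped BigOperators
open IntermediateField Filter

/-- The set `𝒮` of admissible decomposition sequences `(p_i, c_i, s_i)_{i ∈ ℕ}`:
`σ(c_i) = p_{i+1} c_{i+1} s_{i+1}` for all `i ≥ 0`. -/
def SeqS {A : Type*} (σ : A → List A) (x : ℕ → List A × A × List A) : Prop :=
  ∀ i : ℕ, σ ((x i).2.1) = (x (i+1)).1 ++ (x (i+1)).2.1 :: (x (i+1)).2.2

/-- `v(a ; x) = Σ_{i ≥ 1} θ₂^{-i} γ(p_i)` (with `a = c_0^x`). -/
noncomputable def vOf {A : Type*} (θ₂ : ℝ) (γ : A → ℝ) (x : ℕ → List A × A × List A) : ℝ :=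
  ∑' i : ℕ, θ₂ ^ (-(i : ℤ) - 1) * gammaW γ ((x (i+1)).1)

/-- `v(a) = inf { v(a ; x) : x ∈ 𝒮, c_0^x = a }`. -/
noncomputable def vMin {A : Type*} (σ : A → List A) (θ₂ : ℝ) (γ : A → ℝ) (a : A) : ℝ :=
  sInf { v : ℝ | ∃ x : ℕ → List A × A × List A, SeqS σ x ∧ (x 0).2.1 = a ∧ v = vOf θ₂ γ x }

/-- `v_n(a)`: the minimum of `Σ_{i=1}^{n+1} θ₂^{-i} γ(p_i)` over all finite
admissible sequences `(p_i, c_i, s_i)_{i=1}^{n+1}` with `c_0 = a` and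
`σ(c_{i-1}) = p_i c_i s_i` for `1 ≤ i ≤ n+1`. -/
noncomputable def vFin {A : Type*} (σ : A → List A) (θ₂ : ℝ) (γ : A → ℝ) (a : A) (n : ℕ) : ℝ :=
  sInf { v : ℝ | ∃ q : ℕ → List A × A × List A, (q 0).2.1 = a ∧
    (∀ i : ℕ, i ≤ n → σ ((q i).2.1) = (q (i+1)).1 ++ (q (i+1)).2.1 :: (q (i+1)).2.2) ∧
    v = ∑ i ∈ Finset.range (n+1), θ₂ ^ (-(i : ℤ) - 1) * gammaW γ ((q (i+1)).1) }

open Topology in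
/-- Infima of a uniformly convergent sequence of real functions converge to an attained infimum
of the limit. -/
theorem TendstoUniformlyOn.tendsto_sInf_image {X : Type*} {s : Set X} {F : ℕ → X → ℝ} {f : X → ℝ}
    (h : TendstoUniformlyOn F f atTop s) {x : X} (hx : x ∈ s) (hmin : IsMinOn f s x) :
    Tendsto (fun n => sInf (F n '' s)) atTop (𝓝 (f x)) := by
  rw [Metric.tendsto_atTop]
  intro ε hε
  obtain ⟨N, hN⟩ := eventually_atTop.1 (Metric.tendstoUniformlyOn_iff.1 h (ε / 2) (half_pos hε))
  refine ⟨N, fun n hn => ?_⟩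
  have hclose : ∀ y ∈ s, |f y - F n y| < ε / 2 := fun y hy => by
    simpa [Real.dist_eq] using hN n hn y hy
  have hlow : ∀ v ∈ F n '' s, f x - ε / 2 ≤ v := by
    rintro _ ⟨y, hy, rfl⟩
    have h₁ := (abs_lt.1 (hclose y hy)).2
    have h₂ : f x ≤ f y := hmin hy
    linarith
  have hge : f x - ε / 2 ≤ sInf (F n '' s) := le_csInf ⟨_, x, hx, rfl⟩ hlow
  have hle : sInf (F n '' s) ≤ F n x := csInf_le ⟨_, hlow⟩ ⟨x, hx, rfl⟩
  have hx' := (abs_lt.1 (hclose x hx)).1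
  rw [Real.dist_eq, abs_lt]
  constructor <;> linarith

/-- The paths starting at `t₀` for a relation `step`. -/
def pathsFrom {T : Type*} (step : T → T → Prop) (t₀ : T) : Set (ℕ → T) :=
  {x | x 0 = t₀ ∧ ∀ i, step (x i) (x (i + 1))}

/-- A finite path extends to an infinite one when every vertex has a successor. -/
theorem exists_mem_pathsFrom_eq_of_le {T : Type*} {step : T → T → Prop}
    (hex : ∀ t, ∃ u, step t u) (q : ℕ → T) (n : ℕ) (hq : ∀ i < n, step (q i) (q (i + 1))) :
    ∃ x ∈ pathsFrom step (q 0), ∀ i ≤ n, x i = q i := by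
  choose nxt hnxt using hex
  refine ⟨fun i => nxt^[i - n] (q (min i n)), ⟨by simp, fun i => ?_⟩, fun i hi => by simp [hi]⟩
  rcases lt_or_ge i n with h | h
  · have h₁ : i + 1 - n = 0 := by omega
    simpa [h.le, Nat.succ_le_of_lt h, h₁, Nat.sub_eq_zero_of_le h.le] using hq i h
  · have h₁ : i + 1 - n = i - n + 1 := by omega
    simp only [min_eq_right h, min_eq_right (h.trans i.le_succ), h₁, Function.iterate_succ_apply']
    exact hnxt _

/-- On the paths with vertices in a finite set, partial sums of a weighted cost converge uniformly
and the total cost attains its minimum. -/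
theorem exists_isMinOn_pathsFrom {T : Type*} {step : T → T → Prop} {F : Set T} (hF : F.Finite)
    (hstep : ∀ t u, step t u → u ∈ F) (hex : ∀ t, ∃ u, step t u) (t₀ : T) (g : T → ℝ)
    {w : ℕ → ℝ} (hw : ∀ i, 0 ≤ w i) (hws : Summable w) :
    TendstoUniformlyOn (fun n x => ∑ i ∈ Finset.range n, w i * g (x (i + 1)))
      (fun x => ∑' i, w i * g (x (i + 1))) atTop (pathsFrom step t₀) ∧
    ∃ x ∈ pathsFrom step t₀,
      IsMinOn (fun x => ∑' i, w i * g (x (i + 1))) (pathsFrom step t₀) x := by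
  let _ : TopologicalSpace T := ⊥
  have : DiscreteTopology T := ⟨rfl⟩
  obtain ⟨C, hC⟩ := (hF.image fun t => |g t|).bddAbove
  have hbound : ∀ i, ∀ x ∈ pathsFrom step t₀, ‖w i * g (x (i + 1))‖ ≤ w i * C := by
    intro i x hx
    rw [norm_mul, Real.norm_of_nonneg (hw i)]
    exact mul_le_mul_of_nonneg_left (hC ⟨_, hstep _ _ (hx.2 i), rfl⟩) (hw i)
  have hunif := tendstoUniformlyOn_tsum_nat (hws.mul_right C) hbound
  refine ⟨hunif, ?_⟩
  have hclosed : IsClosed (pathsFrom step t₀) := by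
    have hpair (i : ℕ) : Continuous fun x : ℕ → T => (x i, x (i + 1)) :=
      (continuous_apply i).prodMk (continuous_apply (i + 1))
    have hsteps : IsClosed (⋂ i, (fun x : ℕ → T => (x i, x (i + 1))) ⁻¹'
        {p : T × T | step p.1 p.2}) :=
      isClosed_iInter fun i => IsClosed.preimage (hpair i) (isClosed_discrete _)
    convert (isClosed_eq (continuous_apply 0) (continuous_const (y := t₀))).inter hsteps using 1
    ext x
    simp [pathsFrom]
  have hcompact : IsCompact (pathsFrom step t₀) := by
    refine (isCompact_univ_pi fun _ : ℕ => (hF.insert t₀).isCompact).of_isClosed_subset hclosed ?_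
    rintro x ⟨h₀, h⟩ i -
    cases i with
    | zero => exact Or.inl h₀
    | succ i => exact Or.inr (hstep _ _ (h i))
  obtain ⟨x, hx, -⟩ := exists_mem_pathsFrom_eq_of_le hex (fun _ => t₀) 0 (by simp)
  refine hcompact.exists_isMinOn ⟨x, hx⟩ (hunif.continuousOn (Frequently.of_forall fun n => ?_))
  exact (continuous_finsetSum _ fun i _ => continuous_const.mul
    (continuous_of_discreteTopology.comp (continuous_apply (i + 1)))).continuousOn

/-- A substitution on a finite alphabet has finitely many prefix-letter-suffix decompositions. -/
theorem finite_decompositions {A : Type*} [Finite A] (σ : A → List A) :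
    {t : List A × A × List A | ∃ c, σ c = t.1 ++ t.2.1 :: t.2.2}.Finite := by
  rw [Set.ofPred_exists]
  refine Set.finite_iUnion fun c => ?_
  refine ((List.finite_length_le A (σ c).length).prod
    (Set.finite_univ.prod (List.finite_length_le A (σ c).length))).subset ?_
  intro t ht
  have h := congrArg List.length (show σ c = _ from ht)
  simp only [List.length_append, List.length_cons] at h
  refine ⟨?_, trivial, ?_⟩ <;> simp only [Set.mem_ofPred_eq] <;> omega

/-- Lemma 3.6 of the paper: `v(a) = lim_{n → ∞} v_n(a)` and the
infimum defining `v(a)` is attained by some `x ∈ 𝒮` with `c_0^x = a`. -/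
theorem statement_8 {A : Type*} [Fintype A] [DecidableEq A]
    (σ : A → List A) (hσ : ∀ a, σ a ≠ [])
    (hprim : Primitive σ)
    (hMpos : ∀ a b : A, 0 < (σ a).count b)
    (θ₁ θ₂ : ℝ) (hθ₁alg : IsAlgebraic ℚ θ₁)
    (hθ₂1 : 1 < θ₂) (hθ₂θ₁ : θ₂ < θ₁)
    (hconj : Polynomial.aeval θ₂ (minpoly ℚ θ₁) = 0)
    (lam : A → ℚ⟮θ₁⟯) (hlampos : ∀ a, (0:ℝ) < (lam a : ℝ))
    (heig1 : ∀ a, ∑ b : A, ((σ a).count b : ℝ) * (lam b : ℝ) = θ₁ * (lam a : ℝ))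
    (η : ℚ⟮θ₁⟯ →ₐ[ℚ] ℝ) (hη : η (AdjoinSimple.gen ℚ θ₁) = θ₂)
    (γ : A → ℝ) (hγ : ∀ a, γ a = η (lam a))
    (heig2 : ∀ a, ∑ b : A, ((σ a).count b : ℝ) * γ b = θ₂ * γ a)
    (a : A) :
    Filter.Tendsto (fun n : ℕ => vFin σ θ₂ γ a n) Filter.atTop (nhds (vMin σ θ₂ γ a)) ∧
    ∃ x : ℕ → List A × A × List A, SeqS σ x ∧ (x 0).2.1 = a ∧ vOf θ₂ γ x = vMin σ θ₂ γ a := by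
  let step : List A × A × List A → List A × A × List A → Prop :=
    fun t u => σ t.2.1 = u.1 ++ u.2.1 :: u.2.2
  have hex : ∀ t, ∃ u, step t u := fun t => by
    obtain ⟨b, l, h⟩ := List.exists_cons_of_ne_nil (hσ t.2.1)
    exact ⟨([], b, l), h⟩
  let t₀ : List A × A × List A := ([], a, [])
  let w : ℕ → ℝ := fun i => θ₂ ^ (-(i : ℤ) - 1)
  have hθ₀ : 0 < θ₂ := one_pos.trans hθ₂1
  have hw : ∀ i, 0 ≤ w i := fun i => (zpow_pos hθ₀ _).le
  have hws : Summable w := by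
    have hgeom := (summable_geometric_of_lt_one (inv_nonneg.2 hθ₀.le)
      (inv_lt_one_of_one_lt₀ hθ₂1)).mul_right θ₂⁻¹
    refine hgeom.congr fun i => ?_
    simp only [w]
    rw [zpow_sub₀ hθ₀.ne', zpow_neg, zpow_natCast, zpow_one, inv_pow, div_eq_mul_inv]
  obtain ⟨hunif, x, hx, hmin⟩ := exists_isMinOn_pathsFrom (step := step) (finite_decompositions σ)
    (fun t _ h => ⟨t.2.1, h⟩) hex t₀ (fun t => gammaW γ t.1) hw hws
  have hreset : ∀ q : ℕ → List A × A × List A, (q 0).2.1 = a →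
      ∀ i, (Function.update q 0 t₀ i).2.1 = (q i).2.1 := by
    rintro q h (_ | i)
    · simp [t₀, h]
    · simp
  have hvMin : vMin σ θ₂ γ a = vOf θ₂ γ x := by
    refine IsLeast.csInf_eq ⟨⟨x, hx.2, by rw [hx.1], rfl⟩, ?_⟩
    rintro _ ⟨q, hq, hq₀, rfl⟩
    have h := hmin (a := Function.update q 0 t₀) ⟨by simp, fun i => by
      simpa [step, hreset q hq₀] using hq i⟩
    simpa [vOf, w] using h
  have hvFin : ∀ n, vFin σ θ₂ γ a n =
      sInf ((fun x : ℕ → List A × A × List A =>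
        ∑ i ∈ Finset.range (n + 1), w i * gammaW γ (x (i + 1)).1) '' pathsFrom step t₀) := by
    intro n
    refine congrArg sInf (Set.ext fun v => ⟨?_, ?_⟩)
    · rintro ⟨q, hq₀, hq, rfl⟩
      obtain ⟨y, hy, hyq⟩ := exists_mem_pathsFrom_eq_of_le hex (Function.update q 0 t₀) (n + 1)
        fun i hi => by simpa [step, hreset q hq₀] using hq i (Nat.le_of_lt_succ hi)
      refine ⟨y, by simpa using hy, Finset.sum_congr rfl fun i hi => ?_⟩
      rw [hyq (i + 1) (Finset.mem_range.1 hi)]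
      simp [w]
    · rintro ⟨y, hy, rfl⟩
      exact ⟨y, by rw [hy.1], fun i _ => hy.2 i, rfl⟩
  refine ⟨?_, x, hx.2, by rw [hx.1], hvMin.symm⟩
  rw [hvMin, funext hvFin]
  exact (hunif.tendsto_sInf_image hx hmin).comp (tendsto_add_atTop_nat 1)
end

section
/- Let a ∈ A and let (p̄_j,c̄_j,s̄_j)_{j=1}^l be a finite sequence in A* × A × A* with c̄_0 = a and σ(c̄_{j-1}) = p̄_j c̄_j s̄_j for 1 ≤ j ≤ l. Suppose that for infinitely many n ∈ ℕ there is a finite sequence (p_i,c_i,s_i)_{i=1}^{n+1} with c_0 = a, σ(c_{i-1}) = p_i c_i s_i for all i, attaining the minimum v_n(a) of Σ_{i=1}^{n+1} θ_2^{-i} γ(p_i) over all such sequences, and whose initial segment satisfies (p_j,c_j,s_j) = (p̄_j,c̄_j,s̄_j) for 1 ≤ j ≤ l. Then there exists y ∈ 𝒮 with c_0^y = a, y_j = (p̄_j,c̄_j,s̄_j) for 1 ≤ j ≤ l, and v(a;y) = v(a). -/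
open scoped BigOperators
open IntermediateField Filter

/-- The triples `(p, c, s)` with `σ(b) = p c s` for some letter `b`. -/
def splittings {A : Type*} (σ : A → List A) : Set (List A × A × List A) :=
  {t | ∃ b, σ b = t.1 ++ t.2.1 :: t.2.2}

theorem finite_splittings {A : Type*} [Finite A] (σ : A → List A) : (splittings σ).Finite := by
  have h : splittings σ = ⋃ b, {t | σ b = t.1 ++ t.2.1 :: t.2.2} := by
    ext t
    simp [splittings]
  rw [h]
  refine Set.finite_iUnion fun b => ?_
  refine Set.Finite.of_injOn (f := fun t => t.1.length) (t := Set.Iio (σ b).length) ?_ ?_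
    (Set.finite_Iio _)
  · intro t ht
    have ht' : σ b = t.1 ++ t.2.1 :: t.2.2 := ht
    simp [ht']
  · rintro ⟨p, c, s⟩ ht ⟨p', c', s'⟩ ht' hlen
    obtain ⟨h₁, h₂⟩ := List.append_inj (Eq.trans (Eq.symm ht) ht') hlen
    simp_all

theorem exists_abs_gammaW_le {A : Type*} [Finite A] (σ : A → List A) (γ : A → ℝ) :
    ∃ C, ∀ t ∈ splittings σ, |gammaW γ t.1| ≤ C := by
  obtain ⟨C, hC⟩ := ((finite_splittings σ).image fun t => |gammaW γ t.1|).bddAbove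
  exact ⟨C, fun t ht => hC ⟨t, ht, rfl⟩⟩

theorem Ultrafilter.exists_eventually_eq {ι T : Type*} (U : Ultrafilter ι) {s : Set T}
    (hs : s.Finite) {f : ι → T} (hf : ∀ᶠ i in (U : Filter ι), f i ∈ s) :
    ∃ t, ∀ᶠ i in (U : Filter ι), f i = t := by
  have h : ∀ᶠ i in (U : Filter ι), ∃ t ∈ s, f i = t := hf.mono fun i hi => ⟨_, hi, rfl⟩
  obtain ⟨t, -, ht⟩ := (Ultrafilter.eventually_exists_mem_iff hs).1 h
  exact ⟨t, ht⟩

theorem summable_zpow_neg_sub_one {θ : ℝ} (hθ : 1 < θ) (C : ℝ) :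
    Summable fun i : ℕ => θ ^ (-(i : ℤ) - 1) * C := by
  have h0 : θ ≠ 0 := by positivity
  have h : Summable fun i : ℕ => θ⁻¹ ^ i * (θ⁻¹ * C) :=
    (summable_geometric_of_lt_one (by positivity) (inv_lt_one_of_one_lt₀ hθ)).mul_right _
  refine h.congr fun i => ?_
  rw [zpow_sub₀ h0, zpow_neg, zpow_natCast, zpow_one, inv_pow]
  ring

theorem abs_term_le {A : Type*} {γ : A → ℝ} {θ C : ℝ} (hθ : 1 < θ) {p : List A}
    (hp : |gammaW γ p| ≤ C) (i : ℕ) :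
    |θ ^ (-(i : ℤ) - 1) * gammaW γ p| ≤ θ ^ (-(i : ℤ) - 1) * C := by
  have h : 0 ≤ θ ^ (-(i : ℤ) - 1) := by positivity
  rw [abs_mul, abs_of_nonneg h]
  gcongr

theorem vFin_le_sum {A : Type*} [Finite A] {σ : A → List A} {θ : ℝ} (hθ : 1 < θ) {γ : A → ℝ}
    {a : A} {n : ℕ} {q : ℕ → List A × A × List A} (h0 : (q 0).2.1 = a)
    (hq : ∀ i ≤ n, σ ((q i).2.1) = (q (i + 1)).1 ++ (q (i + 1)).2.1 :: (q (i + 1)).2.2) :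
    vFin σ θ γ a n ≤ ∑ i ∈ Finset.range (n + 1), θ ^ (-(i : ℤ) - 1) * gammaW γ ((q (i + 1)).1) := by
  obtain ⟨C, hC⟩ := exists_abs_gammaW_le σ γ
  refine csInf_le ⟨∑ i ∈ Finset.range (n + 1), -(θ ^ (-(i : ℤ) - 1) * C), ?_⟩ ⟨q, h0, hq, rfl⟩
  rintro _ ⟨r, -, hr, rfl⟩
  refine Finset.sum_le_sum fun i hi => ?_
  have hi' : i ≤ n := Nat.lt_succ_iff.1 (Finset.mem_range.1 hi)
  exact (abs_le.1 (abs_term_le hθ (hC _ ⟨_, hr i hi'⟩) i)).1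

/-- Finite sequences of lengths tending to infinity that converge termwise to `y` have their
weighted sums converging to `vOf θ γ y`. -/
theorem tendsto_sum_vOf {A : Type*} [Finite A] {σ : A → List A} {θ : ℝ} (hθ : 1 < θ) {γ : A → ℝ}
    {F : Filter ℕ} {n : ℕ → ℕ} (hn : Tendsto n F atTop) {q : ℕ → ℕ → List A × A × List A}
    (hq : ∀ N, ∀ i ≤ n N,
      σ ((q N i).2.1) = (q N (i + 1)).1 ++ (q N (i + 1)).2.1 :: (q N (i + 1)).2.2)
    {y : ℕ → List A × A × List A} (hy : ∀ i, ∀ᶠ N in F, q N i = y i) :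
    Tendsto (fun N => ∑ i ∈ Finset.range (n N + 1),
      θ ^ (-(i : ℤ) - 1) * gammaW γ ((q N (i + 1)).1)) F (nhds (vOf θ γ y)) := by
  obtain ⟨C, hC⟩ := exists_abs_gammaW_le σ γ
  let f : ℕ → ℕ → ℝ := fun N i =>
    if i ∈ Finset.range (n N + 1) then θ ^ (-(i : ℤ) - 1) * gammaW γ ((q N (i + 1)).1) else 0
  have hf : ∀ N, ∑ i ∈ Finset.range (n N + 1), θ ^ (-(i : ℤ) - 1) * gammaW γ ((q N (i + 1)).1)
      = ∑' i, f N i := fun N => by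
    rw [tsum_eq_sum (s := Finset.range (n N + 1)) fun i hi => if_neg hi]
    exact Finset.sum_congr rfl fun i hi => (if_pos hi).symm
  simp only [hf]
  refine tendsto_tsum_of_dominated_convergence (summable_zpow_neg_sub_one hθ |C|) (fun i => ?_)
    (Eventually.of_forall fun N i => ?_)
  · refine tendsto_const_nhds.congr' ?_
    filter_upwards [hy (i + 1), hn.eventually_ge_atTop i] with N h₁ h₂
    simp only [f, if_pos (Finset.mem_range.2 (Nat.lt_succ_iff.2 h₂)), h₁]
  · by_cases hi : i ∈ Finset.range (n N + 1)
    · simp only [f, if_pos hi, Real.norm_eq_abs]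
      have hi' : i ≤ n N := Nat.lt_succ_iff.1 (Finset.mem_range.1 hi)
      exact abs_term_le hθ ((hC _ ⟨_, hq N i hi'⟩).trans (le_abs_self C)) i
    · simp only [f, if_neg hi, norm_zero]
      positivity

/-- Lemma 3.7 of the paper: if for infinitely many `n` there is a
finite sequence attaining the minimum `v_n(a)` and starting with a given admissible
block `(p̄_j, c̄_j, s̄_j)_{j=1}^l`, then there is `y ∈ 𝒮` with `c_0^y = a`, agreeing
with the block on `1 ≤ j ≤ l`, and `v(a ; y) = v(a)`. -/
theorem statement_9 {A : Type*} [Fintype A] [DecidableEq A]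
    (σ : A → List A) (hσ : ∀ a, σ a ≠ [])
    (hprim : Primitive σ)
    (hMpos : ∀ a b : A, 0 < (σ a).count b)
    (θ₁ θ₂ : ℝ) (hθ₁alg : IsAlgebraic ℚ θ₁)
    (hθ₂1 : 1 < θ₂) (hθ₂θ₁ : θ₂ < θ₁)
    (hconj : Polynomial.aeval θ₂ (minpoly ℚ θ₁) = 0)
    (lam : A → ℚ⟮θ₁⟯) (hlampos : ∀ a, (0:ℝ) < (lam a : ℝ))
    (heig1 : ∀ a, ∑ b : A, ((σ a).count b : ℝ) * (lam b : ℝ) = θ₁ * (lam a : ℝ))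
    (η : ℚ⟮θ₁⟯ →ₐ[ℚ] ℝ) (hη : η (AdjoinSimple.gen ℚ θ₁) = θ₂)
    (γ : A → ℝ) (hγ : ∀ a, γ a = η (lam a))
    (heig2 : ∀ a, ∑ b : A, ((σ a).count b : ℝ) * γ b = θ₂ * γ a)
    (a : A) (l : ℕ) (bar : ℕ → List A × A × List A)
    (hbar0 : (bar 0).2.1 = a)
    (hbarchain : ∀ j : ℕ, j < l →
      σ ((bar j).2.1) = (bar (j+1)).1 ++ (bar (j+1)).2.1 :: (bar (j+1)).2.2)
    (hinf : ∀ N : ℕ, ∃ n : ℕ, N ≤ n ∧ ∃ q : ℕ → List A × A × List A,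
      (q 0).2.1 = a ∧
      (∀ i : ℕ, i ≤ n → σ ((q i).2.1) = (q (i+1)).1 ++ (q (i+1)).2.1 :: (q (i+1)).2.2) ∧
      (∑ i ∈ Finset.range (n+1), θ₂ ^ (-(i : ℤ) - 1) * gammaW γ ((q (i+1)).1)
        = vFin σ θ₂ γ a n) ∧
      (∀ j : ℕ, 1 ≤ j → j ≤ l → q j = bar j)) :
    ∃ y : ℕ → List A × A × List A, SeqS σ y ∧ (y 0).2.1 = a ∧
      (∀ j : ℕ, 1 ≤ j → j ≤ l → y j = bar j) ∧
      vOf θ₂ γ y = vMin σ θ₂ γ a := by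
  choose n hn q hq0 hqchain hqmin hqbar using hinf
  have hntop : Tendsto n atTop atTop := tendsto_atTop_mono hn tendsto_id
  let U : Ultrafilter ℕ := Ultrafilter.of atTop
  have hU : (U : Filter ℕ) ≤ atTop := Ultrafilter.of_le atTop
  let r : ℕ → ℕ → List A × A × List A := fun N i => if i = 0 then bar 0 else q N i
  have hr0 : ∀ N, r N 0 = bar 0 := fun N => if_pos rfl
  have hrs : ∀ N i, r N (i + 1) = q N (i + 1) := fun N i => if_neg i.succ_ne_zero
  have hrchain : ∀ N, ∀ i ≤ n N,
      σ ((r N i).2.1) = (r N (i + 1)).1 ++ (r N (i + 1)).2.1 :: (r N (i + 1)).2.2 := by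
    intro N i hi
    have h : (r N i).2.1 = (q N i).2.1 := by
      cases i with
      | zero => rw [hr0, hbar0, hq0]
      | succ i => rw [hrs]
    rw [h, hrs]
    exact hqchain N i hi
  have hlim : ∀ i, ∃ t, ∀ᶠ N in (U : Filter ℕ), r N i = t := by
    intro i
    cases i with
    | zero => exact ⟨bar 0, Eventually.of_forall hr0⟩
    | succ i =>
      refine U.exists_eventually_eq (finite_splittings σ) ?_
      filter_upwards [hU (hntop.eventually_ge_atTop i)] with N hN
      exact ⟨_, hrchain N i hN⟩
  choose y hy using hlim
  have hyS : SeqS σ y := by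
    intro i
    obtain ⟨N, h₁, h₂, h₃⟩ :=
      ((hy i).and ((hy (i + 1)).and (hU (hntop.eventually_ge_atTop i)))).exists
    rw [← h₁, ← h₂]
    exact hrchain N i h₃
  have hy0 : (y 0).2.1 = a := by
    obtain ⟨N, hN⟩ := (hy 0).exists
    rw [← hN, hr0, hbar0]
  refine ⟨y, hyS, hy0, fun j hj hjl => ?_, ?_⟩
  · obtain ⟨N, hN⟩ := (hy j).exists
    obtain ⟨i, rfl⟩ := Nat.exists_eq_add_of_le' hj
    rw [← hN, hrs, hqbar N _ hj hjl]
  · symm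
    refine IsLeast.csInf_eq ⟨⟨y, hyS, hy0, rfl⟩, ?_⟩
    rintro _ ⟨x, hxS, hx0, rfl⟩
    refine le_of_tendsto_of_tendsto'
      (tendsto_sum_vOf (γ := γ) hθ₂1 (hntop.mono_left hU) hrchain hy)
      (tendsto_sum_vOf (γ := γ) (q := fun _ => x) hθ₂1 (hntop.mono_left hU)
        (fun _ i _ => hxS i) fun _ => Eventually.of_forall fun _ => rfl) fun N => ?_
    simp only [hrs, hqmin N]
    exact vFin_le_sum hθ₂1 hx0 fun i _ => hxS i
end

section
/- Let T be an interval exchange transformation on [0,1) with subdivision points 0 = a_0 < a_1 < … < a_r = 1, let γ = (γ_1,…,γ_r) ∈ ℝ^r, let t ∈ [0,1), and let x ∈ {1,…,r}^ℤ be the coding of t, i.e. x_n = i iff T^n(t) ∈ [a_{i−1},a_i). For a word x_m…x_n write γ(x_m…x_n) = γ_{x_m} + … + γ_{x_n}. Assume K := Σ_{n≥1} e^{γ(x_{−n}…x_{−1})} + 1 + Σ_{n≥1} e^{−γ(x_0…x_{n−1})} < ∞ and define the probability measure μ_t = (1/K)( Σ_{n≥1} e^{γ(x_{−n}…x_{−1})}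 δ_{T^{−n}(t)} + δ_t + Σ_{n≥1} e^{−γ(x_0…x_{n−1})} δ_{T^n(t)} ) on [0,1). Then for every Borel set I ⊆ [0,1), μ_t(T(I)) = Σ_{i=1}^r e^{−γ_i} μ_t(I ∩ [a_{i−1},a_i)). -/
open scoped BigOperators
open IntermediateField Filter

/-- The left endpoint of the image of the `i`-th interval under the interval exchange. -/
def ietOffset {r : ℕ} (a : Fin (r+1) → ℝ) (π : Equiv.Perm (Fin r)) (i : Fin r) : ℝ :=
  ∑ j ∈ Finset.univ.filter (fun j : Fin r => π j < π i), (a j.succ - a j.castSucc)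

lemma ietOffset_add_length_le {r : ℕ} {a : Fin (r+1) → ℝ} (hamono : StrictMono a)
    (π : Equiv.Perm (Fin r)) {i k : Fin r} (hik : π i < π k) :
    ietOffset a π i + (a i.succ - a i.castSucc) ≤ ietOffset a π k := by
  unfold ietOffset
  rw [add_comm, ← Finset.sum_insert (s := Finset.univ.filter (fun j : Fin r => π j < π i))
    (a := i) (f := fun j => a j.succ - a j.castSucc) (by simp)]
  refine Finset.sum_le_sum_of_subset_of_nonneg ?_ ?_
  · intro j hj
    simp only [Finset.mem_insert, Finset.mem_filter, Finset.mem_univ, true_and] at hj ⊢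
    rcases hj with rfl | hj
    · exact hik
    · exact hj.trans hik
  · intro j _ _
    exact sub_nonneg.2 (hamono j.castSucc_lt_succ).le

lemma exists_mem_Ico_subdivision {r : ℕ} {a : Fin (r+1) → ℝ} {s : ℝ}
    (h0 : a 0 ≤ s) (h1 : s < a (Fin.last r)) :
    ∃ i : Fin r, s ∈ Set.Ico (a i.castSucc) (a i.succ) := by
  by_contra! h
  have key : ∀ k : Fin (r+1), a k ≤ s := by
    intro k
    induction k using Fin.induction with
    | zero => exact h0
    | succ i ih =>
      by_contra! hlt
      exact h i ⟨ih, hlt⟩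
  exact (key _).not_gt h1

lemma eq_of_mem_Ico_subdivision {r : ℕ} {a : Fin (r+1) → ℝ} (hamono : StrictMono a)
    {s : ℝ} {i k : Fin r} (hi : s ∈ Set.Ico (a i.castSucc) (a i.succ))
    (hk : s ∈ Set.Ico (a k.castSucc) (a k.succ)) : i = k := by
  have h1 := hamono.lt_iff_lt.1 (hi.1.trans_lt hk.2)
  have h2 := hamono.lt_iff_lt.1 (hk.1.trans_lt hi.2)
  simp only [Fin.lt_def, Fin.val_castSucc, Fin.val_succ] at h1 h2
  ext
  omega

lemma iet_injOn {r : ℕ} {a : Fin (r+1) → ℝ} (hamono : StrictMono a)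
    {π : Equiv.Perm (Fin r)} {T : ℝ → ℝ}
    (hT : ∀ i : Fin r, ∀ t ∈ Set.Ico (a i.castSucc) (a i.succ),
      T t = t - a i.castSucc + ietOffset a π i) :
    Set.InjOn T (Set.Ico (a 0) (a (Fin.last r))) := by
  have not_gt : ∀ {s s' : ℝ} {i k : Fin r}, s ∈ Set.Ico (a i.castSucc) (a i.succ) →
      s' ∈ Set.Ico (a k.castSucc) (a k.succ) → T s = T s' → ¬ π i < π k := by
    intro s s' i k hi hk h hlt
    have := ietOffset_add_length_le hamono π hlt
    rw [hT i s hi, hT k s' hk] at h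
    linarith [hi.2, hk.1]
  intro s hs s' hs' h
  obtain ⟨i, hi⟩ := exists_mem_Ico_subdivision hs.1 hs.2
  obtain ⟨k, hk⟩ := exists_mem_Ico_subdivision hs'.1 hs'.2
  obtain rfl : i = k := π.injective
    (le_antisymm (le_of_not_gt (not_gt hk hi h.symm)) (le_of_not_gt (not_gt hi hk h)))
  rw [hT i s hi, hT i s' hk] at h
  linarith

lemma gammaW_wordOf {A : Type*} (γ : A → ℝ) (x : ℤ → A) (m : ℤ) (len : ℕ) :
    gammaW γ (wordOf x m len) = ∑ k ∈ Finset.range len, γ (x (m + k)) := by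
  induction len with
  | zero => simp [gammaW, wordOf]
  | succ len ih =>
    rw [Finset.sum_range_succ, ← ih]
    simp [gammaW, wordOf, List.range_succ]

/-- The cocycle over `ℤ` with increments `γ (x n)`, vanishing at `0`. -/
def gammaCocycle {A : Type*} (γ : A → ℝ) (x : ℤ → A) : ℤ → ℝ
  | Int.ofNat n => gammaW γ (wordOf x 0 n)
  | Int.negSucc n => -gammaW γ (wordOf x (-(n : ℤ) - 1) (n+1))

lemma gammaCocycle_natCast {A : Type*} (γ : A → ℝ) (x : ℤ → A) (n : ℕ) :
    gammaCocycle γ x n = gammaW γ (wordOf x 0 n) := rfl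

lemma gammaCocycle_neg_succ {A : Type*} (γ : A → ℝ) (x : ℤ → A) (n : ℕ) :
    gammaCocycle γ x (-((n : ℤ) + 1)) = -gammaW γ (wordOf x (-(n : ℤ) - 1) (n+1)) := by
  rw [← Int.negSucc_eq]
  rfl

lemma gammaCocycle_add_one {A : Type*} (γ : A → ℝ) (x : ℤ → A) (n : ℤ) :
    gammaCocycle γ x (n + 1) = gammaCocycle γ x n + γ (x n) := by
  obtain ⟨m, rfl | rfl⟩ : ∃ m : ℕ, n = m ∨ n = -((m : ℤ) + 1) := by
    rcases n with m | m
    · exact ⟨m, Or.inl rfl⟩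
    · exact ⟨m, Or.inr (by omega)⟩
  · rw [← Int.natCast_succ, gammaCocycle_natCast, gammaCocycle_natCast, gammaW_wordOf,
      gammaW_wordOf, Finset.sum_range_succ, zero_add]
  · rw [gammaCocycle_neg_succ, gammaW_wordOf, Finset.sum_range_succ']
    cases m with
    | zero =>
      have h := gammaCocycle_natCast γ x 0
      rw [gammaW_wordOf] at h
      simpa using h
    | succ m =>
      have h : (-(((m + 1 : ℕ) : ℤ) + 1) + 1) = -((m : ℤ) + 1) := by push_cast; ring
      rw [h, gammaCocycle_neg_succ, gammaW_wordOf]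
      have h1 : ∀ k : ℕ, -((m + 1 : ℕ) : ℤ) - 1 + ((k + 1 : ℕ) : ℤ) = -(m : ℤ) - 1 + k := by
        intro k; push_cast; ring
      have h2 : -((m + 1 : ℕ) : ℤ) - 1 + ((0 : ℕ) : ℤ) = -(((m + 1 : ℕ) : ℤ) + 1) := by
        push_cast; ring
      simp only [h1, h2]
      ring

open MeasureTheory in
/-- Lemma 4.1 of the paper. Let `T` be the interval exchange
transformation on `[0,1)` with subdivision points `a 0 = 0 < … < a r = 1` and
permutation `π`, let `t ∈ [0,1)` with full `T`-orbit `o : ℤ → [0,1)` and coding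
`x`. With `K = Σ_{n ≥ 1} e^{γ(x_{-n} … x_{-1})} + 1 + Σ_{n ≥ 1} e^{-γ(x_0 … x_{n-1})}`
finite, the probability measure
`μ_t = (1/K)(Σ_{n ≥ 1} e^{γ(x_{-n} … x_{-1})} δ_{T^{-n} t} + δ_t +
Σ_{n ≥ 1} e^{-γ(x_0 … x_{n-1})} δ_{T^n t})`
satisfies `μ_t(T(I)) = Σ_{i=1}^r e^{-γ_i} μ_t(I ∩ [a_{i-1}, a_i))` for every Borel
set `I ⊆ [0,1)`. -/
theorem statement_17 (r : ℕ)
    (a : Fin (r+1) → ℝ) (ha0 : a 0 = 0) (har : a (Fin.last r) = 1) (hamono : StrictMono a)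
    (π : Equiv.Perm (Fin r)) (T : ℝ → ℝ)
    (hT : ∀ i : Fin r, ∀ t ∈ Set.Ico (a i.castSucc) (a i.succ),
      T t = t - a i.castSucc +
        ∑ j ∈ Finset.univ.filter (fun j : Fin r => π j < π i), (a j.succ - a j.castSucc))
    (γ : Fin r → ℝ)
    (t : ℝ) (ht : t ∈ Set.Ico (0:ℝ) 1)
    (o : ℤ → ℝ) (ho0 : o 0 = t) (horb : ∀ n : ℤ, o n ∈ Set.Ico (0:ℝ) 1)
    (hoT : ∀ n : ℤ, T (o n) = o (n+1))
    (x : ℤ → Fin r)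
    (hcode : ∀ n : ℤ, o n ∈ Set.Ico (a ((x n).castSucc)) (a ((x n).succ)))
    (hsum1 : Summable (fun n : ℕ => Real.exp (gammaW γ (wordOf x (-(n : ℤ) - 1) (n+1)))))
    (hsum2 : Summable (fun n : ℕ => Real.exp (-(gammaW γ (wordOf x 0 (n+1))))))
    (K : ℝ)
    (hK : K = (∑' n : ℕ, Real.exp (gammaW γ (wordOf x (-(n : ℤ) - 1) (n+1)))) + 1
      + (∑' n : ℕ, Real.exp (-(gammaW γ (wordOf x 0 (n+1))))))
    (μ : Measure ℝ)
    (hμ : μ = Measure.sum (fun n : ℕ =>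
        ENNReal.ofReal (Real.exp (gammaW γ (wordOf x (-(n : ℤ) - 1) (n+1))) / K) •
          Measure.dirac (o (-(n : ℤ) - 1)))
      + ENNReal.ofReal (1 / K) • Measure.dirac t
      + Measure.sum (fun n : ℕ =>
        ENNReal.ofReal (Real.exp (-(gammaW γ (wordOf x 0 (n+1)))) / K) •
          Measure.dirac (o ((n : ℤ) + 1)))) :
    ∀ I : Set ℝ, MeasurableSet I → I ⊆ Set.Ico 0 1 →
      μ (T '' I) = ∑ i : Fin r,
        ENNReal.ofReal (Real.exp (-(γ i))) * μ (I ∩ Set.Ico (a i.castSucc) (a i.succ)) := by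
  intro I _ hI
  subst ho0
  let w : ℤ → ENNReal := fun n => ENNReal.ofReal (Real.exp (-gammaCocycle γ x n) / K)
  have w_succ (n : ℤ) : w (n + 1) = ENNReal.ofReal (Real.exp (-γ (x n))) * w n := by
    simp only [w]
    rw [gammaCocycle_add_one, ← ENNReal.ofReal_mul (Real.exp_pos _).le, neg_add, Real.exp_add]
    congr 1
    ring
  have μ_apply (A : Set ℝ) : μ A = ∑' n : ℤ, w n * A.indicator 1 (o n) := by
    have hZ : ∑' n : ℤ, w n * A.indicator 1 (o n) =
        (∑' n : ℕ, w n * A.indicator 1 (o n)) +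
          ∑' n : ℕ, w (-((n : ℤ) + 1)) * A.indicator 1 (o (-((n : ℤ) + 1))) :=
      (HasSum.of_nat_of_neg_add_one ENNReal.summable.hasSum ENNReal.summable.hasSum).tsum_eq
    rw [hZ, tsum_eq_zero_add' ENNReal.summable, hμ]
    have h0 : gammaW γ (wordOf x 0 0) = 0 := by simp [gammaW_wordOf]
    simp only [Measure.add_apply, Measure.smul_apply, Measure.sum_apply_of_countable,
      Measure.dirac_apply, smul_eq_mul, w, gammaCocycle_neg_succ, gammaCocycle_natCast, neg_neg,
      h0, neg_zero, Real.exp_zero]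
    simp only [neg_add', Nat.cast_zero, Nat.cast_add, Nat.cast_one]
    ring
  have hinj : Set.InjOn T (Set.Ico 0 1) := by
    rw [← ha0, ← har]
    exact iet_injOn hamono hT
  have mem_image (n : ℤ) : o (n + 1) ∈ T '' I ↔ o n ∈ I := by
    rw [← hoT n]
    exact hinj.mem_image_iff hI (horb n)
  rw [μ_apply, ← (Equiv.addRight (1 : ℤ)).tsum_eq]
  simp only [μ_apply, ← ENNReal.tsum_mul_left]
  rw [← Summable.tsum_finsetSum fun _ _ => ENNReal.summable]
  refine tsum_congr fun n => ?_
  have mem_iff (i : Fin r) :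
      o n ∈ I ∩ Set.Ico (a i.castSucc) (a i.succ) ↔ o n ∈ I ∧ x n = i :=
    and_congr_right fun _ =>
      ⟨fun h => eq_of_mem_Ico_subdivision hamono (hcode n) h, fun h => h ▸ hcode n⟩
  classical
  simp only [Equiv.coe_addRight, w_succ, Set.indicator_apply, mem_image, mem_iff]
  by_cases h : o n ∈ I <;> simp [h]
end
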